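/- arXiv:1807.10905 — 2 statements merged into one kernel-verified Lean document; each statement's English description precedes it below -/
import Mathlib

section
/- Let n ≥ 2, let p be a harmonic homogeneous polynomial of degree m on ℝⁿ, let σ ∈ ℝ and let j ≥ 0 be an integer. Then for every x ∈ ℝⁿ with x ≠ 0: Δ( |x|^{σ+2−m} (log|x|)^j p(x) ) = ((σ+2)(σ+n) − m(m+n−2)) |x|^{σ−m} (log|x|)^j p(x) + j(n+2σ+2) |x|^{σ−m} (log|x|)^{j−1} p(x) + j(j−1) |x|^{σ−m} (log|x|)^{j−2} p(x), where the terms carrying the factors j and j(j−1) are absent when j = 0, respectively j ≤ 1. (In spherical-harmonic notation this is Δ(r^{σ+2}(log r)^j G_m) = (λ_{σ+2} − λ_m) r^σ (log r)^j G_m + j(n+2σ+2) r^σ (log r)^{j−1} G_m + j(j−1) r^σ (log r)^{j−2} G_m, with λ_k = k(k+n−2).) -/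
open Real
open scoped BigOperators

noncomputable section

abbrev E (n : ℕ) := EuclideanSpace ℝ (Fin n)

/-- The Euclidean Laplacian of `f` at `x` (sum of second partial derivatives). -/
def lap (n : ℕ) (f : E n → ℝ) (x : E n) : ℝ :=
  ∑ i : Fin n, fderiv ℝ (fun y => fderiv ℝ f y (EuclideanSpace.single i 1)) x
    (EuclideanSpace.single i 1)

/-- `f` is a (real) polynomial function on `ℝⁿ`. -/
def IsPolyFun (n : ℕ) (f : E n → ℝ) : Prop :=
  ∃ P : MvPolynomial (Fin n) ℝ, ∀ x : E n, f x = MvPolynomial.eval (fun i => x i) P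

/-- `p` is a harmonic homogeneous polynomial of degree `m` on `ℝⁿ`. -/
def IsHHP (n m : ℕ) (p : E n → ℝ) : Prop :=
  IsPolyFun n p ∧ (∀ (c : ℝ) (x : E n), p (c • x) = c ^ m * p x) ∧ ∀ x : E n, lap n p x = 0

theorem IsPolyFun.contDiff {n : ℕ} {p : E n → ℝ} (hp : IsPolyFun n p) {k : WithTop ℕ∞} :
    ContDiff ℝ k p := by
  obtain ⟨P, hP⟩ := hp
  rw [funext hP]
  clear hP
  induction P using MvPolynomial.induction_on with
  | C a => simpa using contDiff_const
  | add P Q hP hQ => simpa using hP.add hQ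
  | mul_X P i hP =>
    simp only [map_mul, MvPolynomial.eval_X]
    exact hP.mul (by fun_prop)

/-- Euler's identity for homogeneous functions. -/
theorem fderiv_apply_self_of_homogeneous {V : Type*} [NormedAddCommGroup V] [NormedSpace ℝ V]
    {m : ℕ} {p : V → ℝ} (hom : ∀ (c : ℝ) (x : V), p (c • x) = c ^ m * p x) {x : V}
    (hd : DifferentiableAt ℝ p x) : fderiv ℝ p x x = m * p x := by
  have h1 : HasDerivAt (fun c : ℝ => p (c • x)) (fderiv ℝ p x x) 1 := by
    have hs : HasDerivAt (fun c : ℝ => c • x) x 1 := by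
      simpa using (hasDerivAt_id (1 : ℝ)).smul_const x
    exact HasFDerivAt.comp_hasDerivAt (1 : ℝ) (by simpa using hd.hasFDerivAt) hs
  have h2 : HasDerivAt (fun c : ℝ => p (c • x)) (m * p x) 1 := by
    simp only [hom]
    simpa using (hasDerivAt_pow m (1 : ℝ)).mul_const (p x)
  exact h1.unique h2

theorem hasFDerivAt_norm_of_ne_zero {V : Type*} [NormedAddCommGroup V] [InnerProductSpace ℝ V]
    {x : V} (hx : x ≠ 0) : HasFDerivAt (fun y : V => ‖y‖) (‖x‖⁻¹ • innerSL ℝ x) x := by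
  have hx' : ‖x‖ ≠ 0 := norm_ne_zero_iff.2 hx
  have h := ((hasStrictFDerivAt_norm_sq x).hasFDerivAt).sqrt (by positivity)
  simp only [Real.sqrt_sq (norm_nonneg _)] at h
  convert h using 1
  ext v
  simp
  field_simp

/-- The Laplacian of a radial function times a harmonic homogeneous polynomial. -/
theorem lap_radial_mul {n m : ℕ} {p : E n → ℝ} (hp : IsHHP n m p) {g h : ℝ → ℝ} {k : ℝ}
    {x : E n} (hx : x ≠ 0) (hg : ∀ r, 0 < r → HasDerivAt g (r * h r) r)
    (hh : HasDerivAt h k ‖x‖) :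
    lap n (fun y => g ‖y‖ * p y) x = (‖x‖ * k + (n + 2 * m) * h ‖x‖) * p x := by
  obtain ⟨hpoly, hom, hharm⟩ := hp
  have hpd : Differentiable ℝ p := (hpoly.contDiff (k := 1)).differentiable (by simp)
  have hpd2 : Differentiable ℝ (fderiv ℝ p) :=
    ((hpoly.contDiff (k := 2)).fderiv_right (m := 1) (by norm_num)).differentiable (by simp)
  have hr : 0 < ‖x‖ := norm_pos_iff.2 hx
  have first (i : Fin n) (y : E n) (hy : y ≠ 0) :
      fderiv ℝ (fun y => g ‖y‖ * p y) y (EuclideanSpace.single i 1) =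
        h ‖y‖ * (y i * p y) + g ‖y‖ * fderiv ℝ p y (EuclideanSpace.single i 1) := by
    have hy' : ‖y‖ ≠ 0 := norm_ne_zero_iff.2 hy
    have := ((hg ‖y‖ (norm_pos_iff.2 hy)).comp_hasFDerivAt y
      (hasFDerivAt_norm_of_ne_zero hy)).mul (hpd y).hasFDerivAt
    rw [HasFDerivAt.fderiv (f := fun y => g ‖y‖ * p y) this]
    simp [EuclideanSpace.inner_single_right]
    field_simp
    ring
  have second (i : Fin n) :
      fderiv ℝ (fun y => fderiv ℝ (fun y => g ‖y‖ * p y) y (EuclideanSpace.single i 1)) x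
        (EuclideanSpace.single i 1) =
        (k * ‖x‖⁻¹ * p x) * (x i) ^ 2 + h ‖x‖ * p x
          + 2 * h ‖x‖ * (x i * fderiv ℝ p x (EuclideanSpace.single i 1))
          + g ‖x‖ * fderiv ℝ (fun y => fderiv ℝ p y (EuclideanSpace.single i 1)) x
              (EuclideanSpace.single i 1) := by
    have hev : (fun y => fderiv ℝ (fun y => g ‖y‖ * p y) y (EuclideanSpace.single i 1)) =ᶠ[nhds x]
        fun y => h ‖y‖ * (y i * p y) + g ‖y‖ * fderiv ℝ p y (EuclideanSpace.single i 1) := by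
      filter_upwards [isOpen_ne.mem_nhds hx] with y hy using first i y hy
    rw [hev.fderiv_eq]
    have hn := hasFDerivAt_norm_of_ne_zero hx
    have hcoord : HasFDerivAt (fun y : E n => y i) (EuclideanSpace.proj (𝕜 := ℝ) i) x :=
      (EuclideanSpace.proj (𝕜 := ℝ) i).hasFDerivAt
    have hdi : DifferentiableAt ℝ (fun y => fderiv ℝ p y (EuclideanSpace.single i 1)) x :=
      (hpd2 x).clm_apply (differentiableAt_const _)
    have := ((hh.comp_hasFDerivAt x hn).mul (hcoord.mul (hpd x).hasFDerivAt)).add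
      (((hg ‖x‖ hr).comp_hasFDerivAt x hn).mul hdi.hasFDerivAt)
    rw [HasFDerivAt.fderiv (f := fun y => h ‖y‖ * (y i * p y) +
      g ‖y‖ * fderiv ℝ p y (EuclideanSpace.single i 1)) this]
    simp [EuclideanSpace.inner_single_right]
    field_simp
    ring
  have heuler : ∑ i, x i * fderiv ℝ p x (EuclideanSpace.single i 1) = m * p x := by
    rw [← fderiv_apply_self_of_homogeneous hom (hpd x)]
    conv_rhs => arg 2; rw [← (EuclideanSpace.basisFun (Fin n) ℝ).sum_repr x]
    simp
  have hharm' := hharm x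
  unfold lap at hharm' ⊢
  simp only [second, Finset.sum_add_distrib, ← Finset.mul_sum, hharm', heuler,
    ← EuclideanSpace.real_norm_sq_eq, Finset.sum_const, Finset.card_univ, Fintype.card_fin,
    nsmul_eq_mul]
  field_simp
  ring

theorem hasDerivAt_rpow_mul_log_pow (b : ℝ) (j : ℕ) {r : ℝ} (hr : 0 < r) :
    HasDerivAt (fun r : ℝ => r ^ b * Real.log r ^ j)
      (b * (r ^ (b - 1) * Real.log r ^ j) + j * (r ^ (b - 1) * Real.log r ^ (j - 1))) r := by
  refine ((Real.hasDerivAt_rpow_const (p := b) (Or.inl hr.ne')).mul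
    ((Real.hasDerivAt_log hr.ne').pow j)).congr_deriv ?_
  rw [Real.rpow_sub_one hr.ne', Pi.pow_apply]
  ring

/-- the Laplacian of `r^{σ+2} (log r)^j G_m`, written as
`|x|^{σ+2-m} (log|x|)^j p(x)` with `p` harmonic homogeneous of degree `m`. -/
theorem laplacian_rpow_log_spherical (n m : ℕ) (hn : 2 ≤ n) (p : E n → ℝ)
    (hp : IsHHP n m p) (σ : ℝ) (j : ℕ) :
    ∀ x : E n, x ≠ 0 →
      lap n (fun y => ‖y‖ ^ (σ + 2 - m) * (Real.log ‖y‖) ^ j * p y) x =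
        ((σ + 2) * (σ + n) - (m:ℝ) * ((m:ℝ) + n - 2)) *
            (‖x‖ ^ (σ - m) * (Real.log ‖x‖) ^ j * p x)
          + (j:ℝ) * ((n:ℝ) + 2 * σ + 2) *
            (‖x‖ ^ (σ - m) * (Real.log ‖x‖) ^ (j - 1) * p x)
          + (j:ℝ) * ((j:ℝ) - 1) *
            (‖x‖ ^ (σ - m) * (Real.log ‖x‖) ^ (j - 2) * p x) := by
  intro x hx
  have hr : 0 < ‖x‖ := norm_pos_iff.2 hx
  set a : ℝ := σ + 2 - m with ha
  have hg : ∀ r : ℝ, 0 < r → HasDerivAt (fun r : ℝ => r ^ a * Real.log r ^ j)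
      (r * (a * (r ^ (a - 2) * Real.log r ^ j)
        + j * (r ^ (a - 2) * Real.log r ^ (j - 1)))) r := by
    intro r hr
    refine (hasDerivAt_rpow_mul_log_pow a j hr).congr_deriv ?_
    rw [show a - 1 = (a - 2) + 1 by ring, Real.rpow_add_one hr.ne']
    ring
  have hh := ((hasDerivAt_rpow_mul_log_pow (a - 2) j hr).const_mul a).add
    ((hasDerivAt_rpow_mul_log_pow (a - 2) (j - 1) hr).const_mul (j : ℝ))
  rw [lap_radial_mul hp hx hg hh, show σ - m = a - 2 by rw [ha]; ring,
    Real.rpow_sub_one hr.ne', Nat.sub_sub]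
  have hj : (j : ℝ) * ((j - 1 : ℕ) : ℝ) = j * (j - 1) := by
    cases j <;> simp
  rw [← hj, show σ = a + m - 2 by rw [ha]; ring]
  field_simp
  ring
end
end

section
/- Let n ≥ 4, let p be a harmonic homogeneous polynomial of degree m on ℝⁿ, let i ≥ 0 be an integer, and let σ ∈ ℝ satisfy σ + n + m ≠ 0 and σ + 2 ≠ m. Then there exist real numbers c₀,…,c_i such that the function u(x) = |x|^{σ+2−m} (Σ_{j=0}^{i} c_j (log|x|)^j) p(x) satisfies Δu(x) = |x|^{σ−m} (log|x|)^i p(x) for all x ∈ ℝⁿ with x ≠ 0. (In spherical-harmonic notation: the equation Δu = r^σ (log r)^i G_m has a solution of the form r^{σ+2}(Σ_{j=0}^{i} c_j (log r)^j) G_m.) -/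
open Real
open scoped BigOperators

noncomputable section

/-- The operator `q ↦ A q + B q' + q''` with `A ≠ 0` maps polynomials of degree `< d` onto
themselves. -/
theorem exists_solution_constant_coeff {A : ℝ} (B : ℝ) (hA : A ≠ 0) (d : ℕ)
    (g : Polynomial ℝ) (hg : g.degree < d) :
    ∃ q : Polynomial ℝ, q.degree < d ∧
      Polynomial.C A * q + Polynomial.C B * q.derivative + q.derivative.derivative = g := by
  induction d generalizing g with
  | zero =>
    have h0 : g = 0 := by simpa using hg
    exact ⟨0, by simp, by simp [h0]⟩
  | succ d ih =>
    have hd1 : g.derivative.degree < d := by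
      rw [Polynomial.degree_lt_iff_coeff_zero] at hg ⊢
      intro k hk
      rw [Polynomial.coeff_derivative, hg (k + 1) (by omega), zero_mul]
    have hd2 : g.derivative.derivative.degree < d :=
      lt_of_le_of_lt Polynomial.degree_derivative_le hd1
    obtain ⟨q, hq, hq'⟩ := ih
      (-(Polynomial.C (A⁻¹) * (Polynomial.C B * g.derivative + g.derivative.derivative))) (by
        rw [Polynomial.degree_lt_iff_coeff_zero] at hd1 hd2 ⊢
        intro k hk
        simp [Polynomial.coeff_C_mul, hd1 k hk, hd2 k hk])
    refine ⟨Polynomial.C A⁻¹ * g + q, ?_, ?_⟩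
    · rw [Polynomial.degree_lt_iff_coeff_zero] at hg hq ⊢
      intro k hk
      simp [Polynomial.coeff_C_mul, hg k hk, hq k (by omega)]
    · have hC : Polynomial.C A * Polynomial.C A⁻¹ = (1 : Polynomial ℝ) := by
        rw [← Polynomial.C_mul, mul_inv_cancel₀ hA, Polynomial.C_1]
      simp only [Polynomial.derivative_add, Polynomial.derivative_C_mul]
      linear_combination hq' + g * hC

/-- Euler's identity for homogeneous functions. -/
theorem fderiv_self_of_homogeneous {n m : ℕ} {p : E n → ℝ} (hd : Differentiable ℝ p)
    (hh : ∀ (c : ℝ) (x : E n), p (c • x) = c ^ m * p x) (x : E n) :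
    fderiv ℝ p x x = m * p x := by
  have h1 : HasDerivAt (fun c : ℝ => c • x) x 1 := by
    simpa using (hasDerivAt_id (1 : ℝ)).smul_const x
  have h2 : HasFDerivAt p (fderiv ℝ p x) ((1 : ℝ) • x) := by
    rw [one_smul]; exact (hd x).hasFDerivAt
  have h3 := h2.comp_hasDerivAt (1 : ℝ) h1
  have h4 : HasDerivAt (fun c : ℝ => c ^ m * p x) (m * p x) 1 := by
    simpa using (hasDerivAt_pow m (1 : ℝ)).mul_const (p x)
  refine h3.unique (h4.congr_of_eventuallyEq (Filter.Eventually.of_forall fun c => hh c x))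

theorem sum_mul_fderiv_single {n : ℕ} (T : E n →L[ℝ] ℝ) (x : E n) :
    ∑ k, x k * T (EuclideanSpace.single k 1) = T x := by
  conv_rhs => rw [← (EuclideanSpace.basisFun (Fin n) ℝ).sum_repr x]
  simp [map_sum]

theorem hasFDerivAt_log_norm {n : ℕ} {x : E n} (hx : x ≠ 0) :
    HasFDerivAt (fun y : E n => Real.log ‖y‖) ((‖x‖ ^ 2)⁻¹ • innerSL ℝ x) x := by
  have h := ((hasStrictFDerivAt_norm_sq x).hasFDerivAt.log (by simpa using hx)).const_mul
    (1 / 2 : ℝ)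
  refine (h.congr_of_eventuallyEq (Filter.Eventually.of_forall fun y => ?_)).congr_fderiv ?_
  · simp [Real.log_pow]
  · ext v
    simp
    ring

/-- The Laplacian of a radial function, written in the variable `log r`, times a homogeneous
harmonic polynomial. -/
theorem lap_comp_log_norm_mul {n m : ℕ} {p : E n → ℝ} (hp : IsHHP n m p)
    {φ φ' φ'' : ℝ → ℝ} (hφ : ∀ t, HasDerivAt φ (φ' t) t) (hφ' : ∀ t, HasDerivAt φ' (φ'' t) t)
    {x : E n} (hx : x ≠ 0) :
    lap n (fun y => φ (Real.log ‖y‖) * p y) x =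
      (‖x‖ ^ 2)⁻¹ * (φ'' (Real.log ‖x‖) + (n - 2 + 2 * m) * φ' (Real.log ‖x‖)) * p x := by
  obtain ⟨hpoly, hhom, hharm⟩ := hp
  have hcd : ContDiff ℝ 2 p := hpoly.contDiff
  have hpd : Differentiable ℝ p := hcd.differentiable (by norm_num)
  have hpd' : Differentiable ℝ (fderiv ℝ p) :=
    (hcd.fderiv_right (m := 1) (by norm_num)).differentiable (by norm_num)
  have first : ∀ (k : Fin n) (y : E n), y ≠ 0 →
      fderiv ℝ (fun y => φ (Real.log ‖y‖) * p y) y (EuclideanSpace.single k 1) =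
        φ' (Real.log ‖y‖) * ((‖y‖ ^ 2)⁻¹ * y k) * p y +
          φ (Real.log ‖y‖) * fderiv ℝ p y (EuclideanSpace.single k 1) := by
    intro k y hy
    have h := ((hφ _).comp_hasFDerivAt y (hasFDerivAt_log_norm hy)).mul (hpd y).hasFDerivAt
    have h' := h.fderiv
    simp only [Function.comp_def] at h'
    change fderiv ℝ (fun y => φ (Real.log ‖y‖) * p y) y = _ at h'
    rw [h']
    simp [EuclideanSpace.inner_single_right]
    ring
  have hn0 : ‖x‖ ≠ 0 := norm_ne_zero_iff.mpr hx
  have second : ∀ k : Fin n,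
      fderiv ℝ (fun y => fderiv ℝ (fun y => φ (Real.log ‖y‖) * p y) y
        (EuclideanSpace.single k 1)) x (EuclideanSpace.single k 1) =
        ((φ'' (Real.log ‖x‖) - 2 * φ' (Real.log ‖x‖)) * ((‖x‖ ^ 2)⁻¹) ^ 2 * p x) * (x k) ^ 2 +
        φ' (Real.log ‖x‖) * (‖x‖ ^ 2)⁻¹ * p x +
        (2 * φ' (Real.log ‖x‖) * (‖x‖ ^ 2)⁻¹) *
          (x k * fderiv ℝ p x (EuclideanSpace.single k 1)) +
        φ (Real.log ‖x‖) * fderiv ℝ (fun y => fderiv ℝ p y (EuclideanSpace.single k 1)) x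
          (EuclideanSpace.single k 1) := by
    intro k
    have hev := (eventually_ne_nhds hx).mono (first k)
    rw [Filter.EventuallyEq.fderiv_eq hev]
    have hL := hasFDerivAt_log_norm hx
    have h1 := (hφ _).comp_hasFDerivAt x hL
    have h2 := (hφ' _).comp_hasFDerivAt x hL
    have h3 := (hasDerivAt_inv (pow_ne_zero 2 hn0)).comp_hasFDerivAt x
      (hasStrictFDerivAt_norm_sq x).hasFDerivAt
    have h4 : HasFDerivAt (fun y : E n => y k) (EuclideanSpace.proj k : E n →L[ℝ] ℝ) x :=
      (EuclideanSpace.proj k : E n →L[ℝ] ℝ).hasFDerivAt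
    have h5 : DifferentiableAt ℝ (fun y => fderiv ℝ p y (EuclideanSpace.single k 1)) x :=
      (hpd' x).clm_apply (differentiableAt_const _)
    have h := ((h2.mul (h3.mul h4)).mul (hpd x).hasFDerivAt).add (h1.mul h5.hasFDerivAt)
    refine (congrArg (fun T : E n →L[ℝ] ℝ => T (EuclideanSpace.single k 1)) h.fderiv).trans ?_
    simp [EuclideanSpace.inner_single_right]
    field_simp
    ring
  have hsq : ∑ k, (x k) ^ 2 = ‖x‖ ^ 2 := (EuclideanSpace.real_norm_sq_eq x).symm
  have hE := (sum_mul_fderiv_single (fderiv ℝ p x) x).trans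
    (fderiv_self_of_homogeneous hpd hhom x)
  have hH := hharm x
  unfold lap at hH ⊢
  rw [Finset.sum_congr rfl fun k _ => second k]
  simp only [Finset.sum_add_distrib, ← Finset.mul_sum, hsq, hE, hH, Finset.sum_const,
    Finset.card_univ, Fintype.card_fin, nsmul_eq_mul]
  field_simp
  ring

theorem lap_congr {n : ℕ} {f g : E n → ℝ} {x : E n} (h : f =ᶠ[nhds x] g) :
    lap n f x = lap n g x := by
  unfold lap
  refine Finset.sum_congr rfl fun k _ => ?_
  have h' : (fun y => fderiv ℝ f y (EuclideanSpace.single k 1)) =ᶠ[nhds x]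
      fun y => fderiv ℝ g y (EuclideanSpace.single k 1) :=
    (h.fderiv (𝕜 := ℝ)).mono fun y hy => by simp only [hy]
  rw [h'.fderiv_eq]

/-- solvability of `Δu = r^σ (log r)^i G_m` in the non-resonant case
`σ + n + m ≠ 0`, `σ + 2 ≠ m`, with a solution `r^{σ+2} (Σ_j c_j (log r)^j) G_m`. -/
theorem poisson_single_term_nonexceptional (n m i : ℕ) (hn : 4 ≤ n) (p : E n → ℝ)
    (hp : IsHHP n m p) (σ : ℝ) (h1 : σ + n + m ≠ 0) (h2 : σ + 2 ≠ (m:ℝ)) :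
    ∃ c : ℕ → ℝ, ∀ x : E n, x ≠ 0 →
      lap n (fun y => ‖y‖ ^ (σ + 2 - m) *
          (∑ j ∈ Finset.range (i + 1), c j * (Real.log ‖y‖) ^ j) * p y) x =
        ‖x‖ ^ (σ - m) * (Real.log ‖x‖) ^ i * p x := by
  set a : ℝ := σ + 2 - m with ha
  have hA : a * (a + n - 2 + 2 * m) ≠ 0 := by
    refine mul_ne_zero (sub_ne_zero.mpr h2) ?_
    rw [ha]
    convert h1 using 1
    ring
  obtain ⟨q, hq, hqe⟩ := exists_solution_constant_coeff (2 * a + n - 2 + 2 * m) hA (i + 1)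
    (Polynomial.X ^ i) (by rw [Polynomial.degree_X_pow]; exact_mod_cast Nat.lt_succ_self i)
  refine ⟨q.coeff, fun x hx => ?_⟩
  have hsum : ∀ t : ℝ, ∑ j ∈ Finset.range (i + 1), q.coeff j * t ^ j = q.eval t := fun t =>
    (Polynomial.eval_eq_sum_range' (Nat.lt_succ_of_le (Polynomial.natDegree_le_iff_coeff_eq_zero.mpr
      fun N hN => (Polynomial.degree_lt_iff_coeff_zero _ _).mp hq N hN)) t).symm
  have hexp : ∀ t : ℝ, HasDerivAt (fun t => Real.exp (a * t)) (a * Real.exp (a * t)) t :=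
    fun t => by simpa [mul_comm] using ((hasDerivAt_id t).const_mul a).exp
  have hφ : ∀ t : ℝ, HasDerivAt (fun t => Real.exp (a * t) * q.eval t)
      (Real.exp (a * t) * (a * q.eval t + q.derivative.eval t)) t := fun t =>
    ((hexp t).mul (q.hasDerivAt t)).congr_deriv (by ring)
  have hφ' : ∀ t : ℝ, HasDerivAt
      (fun t => Real.exp (a * t) * (a * q.eval t + q.derivative.eval t))
      (Real.exp (a * t) * (a ^ 2 * q.eval t + 2 * a * q.derivative.eval t +
        q.derivative.derivative.eval t)) t := fun t =>
    ((hexp t).mul (((q.hasDerivAt t).const_mul a).add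
      (q.derivative.hasDerivAt t))).congr_deriv (by simp only [Pi.add_apply]; ring)
  have hrpow : ∀ y : E n, y ≠ 0 → ‖y‖ ^ a = Real.exp (a * Real.log ‖y‖) := fun y hy => by
    rw [Real.rpow_def_of_pos (norm_pos_iff.mpr hy), mul_comm]
  have hev : (fun y : E n => ‖y‖ ^ a *
        (∑ j ∈ Finset.range (i + 1), q.coeff j * (Real.log ‖y‖) ^ j) * p y) =ᶠ[nhds x]
      fun y => Real.exp (a * Real.log ‖y‖) * q.eval (Real.log ‖y‖) * p y :=
    (eventually_ne_nhds hx).mono fun y hy => by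
      simp only [hsum, hrpow y hy]
  rw [lap_congr hev, lap_comp_log_norm_mul hp hφ hφ' hx]
  have hpow : ‖x‖ ^ (σ - m) = (‖x‖ ^ 2)⁻¹ * Real.exp (a * Real.log ‖x‖) := by
    rw [← hrpow x hx, show σ - m = a - (2 : ℕ) by rw [ha]; push_cast; ring,
      Real.rpow_sub_natCast (norm_ne_zero_iff.mpr hx)]
    ring
  have hq' := congrArg (Polynomial.eval (Real.log ‖x‖)) hqe
  simp only [Polynomial.eval_add, Polynomial.eval_mul, Polynomial.eval_C, Polynomial.eval_pow,
    Polynomial.eval_X] at hq'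
  rw [hpow]
  linear_combination (‖x‖ ^ 2)⁻¹ * Real.exp (a * Real.log ‖x‖) * p x * hq'
end
end
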